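/- For every n ≥ 1 and every k ≥ 0, one has ∑_{σ∈PRW_{n+1}, asc(σ)=k, da(σ)=0} α^{LRmin(σ)+RLmin(σ)−2} = ∑_{σ∈Γ_{n,k}} α^{RLmin(σ)} as an identity of polynomials in ℤ[α], where Γ_{n,k} is the set of permutations σ ∈ S_n with des(σ) = k such that there is no index i with 1 < i < n and σ_{i−1} > σ_i > σ_{i+1}. -/

import Mathlib

/-- The letter at (1-based) position `i` of the word `w`, with the boundary
convention that positions `0` and `> w.length` carry the value `w.length + 1`
(playing the role of `+∞` for a permutation word of `{1,…,n}`). -/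
def wB (w : List ℕ) (i : ℕ) : ℕ :=
  if 1 ≤ i ∧ i ≤ w.length then w.getD (i - 1) 0 else w.length + 1

/-- The one-line word `σ_1 ⋯ σ_n` (with letters in `{1,…,n}`) of a permutation of `Fin n`. -/
def word {n : ℕ} (σ : Equiv.Perm (Fin n)) : List ℕ := List.ofFn (fun i => (σ i : ℕ) + 1)

/-- Number of descents: indices `i ∈ {1,…,n-1}` with `σ_i > σ_{i+1}`. -/
def desW (w : List ℕ) : ℕ :=
  ((Finset.Icc 1 (w.length - 1)).filter (fun i => wB w (i + 1) < wB w i)).card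

/-- Number of ascents: indices `i ∈ {1,…,n-1}` with `σ_i < σ_{i+1}`. -/
def ascW (w : List ℕ) : ℕ :=
  ((Finset.Icc 1 (w.length - 1)).filter (fun i => wB w i < wB w (i + 1))).card

/-- Position `i` is a double ascent: `σ_{i-1} < σ_i < σ_{i+1}` (boundary `σ_0 = σ_{n+1} = +∞`). -/
abbrev isDAat (w : List ℕ) (i : ℕ) : Prop := wB w (i - 1) < wB w i ∧ wB w i < wB w (i + 1)

/-- Position `i` is a double descent: `σ_{i-1} > σ_i > σ_{i+1}`. -/
abbrev isDDat (w : List ℕ) (i : ℕ) : Prop := wB w i < wB w (i - 1) ∧ wB w (i + 1) < wB w i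

/-- Position `i` is a peak: `σ_{i-1} < σ_i > σ_{i+1}`. -/
abbrev isPkat (w : List ℕ) (i : ℕ) : Prop := wB w (i - 1) < wB w i ∧ wB w (i + 1) < wB w i

/-- Position `i` is a valley: `σ_{i-1} > σ_i < σ_{i+1}`. -/
abbrev isVlat (w : List ℕ) (i : ℕ) : Prop := wB w i < wB w (i - 1) ∧ wB w i < wB w (i + 1)

/-- Position `i` holds a left-to-right minimum: `σ_j > σ_i` for all `j < i`. -/
abbrev isLRat (w : List ℕ) (i : ℕ) : Prop := ∀ j ∈ Finset.Icc 1 (i - 1), wB w i < wB w j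

/-- Position `i` holds a right-to-left minimum: `σ_j > σ_i` for all `j > i`. -/
abbrev isRLat (w : List ℕ) (i : ℕ) : Prop := ∀ j ∈ Finset.Icc (i + 1) w.length, wB w i < wB w j

/-- `da`, the number of double ascents. -/
def daW (w : List ℕ) : ℕ := ((Finset.Icc 1 w.length).filter (isDAat w)).card

/-- `dd`, the number of double descents. -/
def ddW (w : List ℕ) : ℕ := ((Finset.Icc 1 w.length).filter (isDDat w)).card

/-- `M`, the number of peaks. -/
def pkW (w : List ℕ) : ℕ := ((Finset.Icc 1 w.length).filter (isPkat w)).card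

/-- `LRmin`, the number of left-to-right minima. -/
def lrminW (w : List ℕ) : ℕ := ((Finset.Icc 1 w.length).filter (isLRat w)).card

/-- `RLmin`, the number of right-to-left minima. -/
def rlminW (w : List ℕ) : ℕ := ((Finset.Icc 1 w.length).filter (isRLat w)).card

/-- The word belongs to `PRW`: if it has an ascent, the first ascent occurs at the letter `1`. -/
abbrev isPRW (w : List ℕ) : Prop :=
  ∀ i ∈ Finset.Icc 1 (w.length - 1), wB w i < wB w (i + 1) →
    (∀ j ∈ Finset.Icc 1 (i - 1), ¬ wB w j < wB w (j + 1)) → wB w i = 1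

/-- The set `PRW_n` of permutations whose first ascent (if any) appears at the letter `1`. -/
def PRW (n : ℕ) : Finset (Equiv.Perm (Fin n)) :=
  Finset.univ.filter (fun σ => isPRW (word σ))

/-- `σ` has no index `1 < i < n` with `σ_{i-1} > σ_i > σ_{i+1}`. -/
abbrev noInternalDD (w : List ℕ) : Prop :=
  ∀ i ∈ Finset.Icc 2 (w.length - 1),
    ¬ (wB w (i + 1) < wB w i ∧ wB w i < wB w (i - 1))


/-- The number of adjacent pairs of letters of a word that satisfy `p`. -/
def adjCount (p : ℕ → ℕ → Prop) [DecidableRel p] : List ℕ → ℕ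
  | a :: b :: l => (if p a b then 1 else 0) + adjCount p (b :: l)
  | _ => 0

/-- No three consecutive letters of the word satisfy `p`. -/
def AvoidsTriple (p : ℕ → ℕ → ℕ → Prop) : List ℕ → Prop
  | a :: b :: c :: l => ¬ p a b c ∧ AvoidsTriple p (b :: c :: l)
  | _ => True

/-- The number of letters of a word that are smaller than all the letters to their right. -/
def rlMin : List ℕ → ℕ
  | [] => 0
  | a :: l => (if ∀ b ∈ l, a < b then 1 else 0) + rlMin l

theorem adjCount_append_cons (p : ℕ → ℕ → Prop) [DecidableRel p] (B : List ℕ) (m : ℕ)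
    (T : List ℕ) : adjCount p (B ++ m :: T) = adjCount p (B ++ [m]) + adjCount p (m :: T) := by
  induction B with
  | nil => simp [adjCount]
  | cons a B ih =>
    cases B with
    | nil => simp [adjCount]
    | cons b B => simp only [List.cons_append, adjCount] at ih ⊢; omega

theorem adjCount_reverse (p : ℕ → ℕ → Prop) [DecidableRel p] (l : List ℕ) :
    adjCount p l.reverse = adjCount (fun a b => p b a) l := by
  induction l with
  | nil => simp [adjCount]
  | cons a l ih =>
    cases l with
    | nil => simp [adjCount]
    | cons b l =>
      simp only [List.reverse_cons, List.append_assoc, adjCount] at ih ⊢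
      rw [← ih, List.singleton_append, adjCount_append_cons]
      simp [adjCount, add_comm]

theorem avoidsTriple_append_cons_cons {p : ℕ → ℕ → ℕ → Prop} (B : List ℕ) {b m : ℕ}
    {T : List ℕ} (h : ∀ c ∈ T, ¬ p b m c) :
    AvoidsTriple p (B ++ b :: m :: T) ↔
      AvoidsTriple p (B ++ [b, m]) ∧ AvoidsTriple p (m :: T) := by
  induction B with
  | nil => cases T <;> simp_all [AvoidsTriple]
  | cons a B ih =>
    rcases B with _ | ⟨x, _ | ⟨y, B⟩⟩ <;> simp_all [AvoidsTriple, and_assoc]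

theorem avoidsTriple_append_triple {p : ℕ → ℕ → ℕ → Prop} (B : List ℕ) (x y z : ℕ) :
    AvoidsTriple p (B ++ [x, y, z]) ↔ AvoidsTriple p (B ++ [x, y]) ∧ ¬ p x y z := by
  induction B with
  | nil => simp [AvoidsTriple]
  | cons a B ih =>
    rcases B with _ | ⟨x, _ | ⟨y, B⟩⟩ <;> simp_all [AvoidsTriple, and_assoc]

theorem avoidsTriple_reverse {p : ℕ → ℕ → ℕ → Prop} (l : List ℕ) :
    AvoidsTriple p l.reverse ↔ AvoidsTriple (fun a b c => p c b a) l := by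
  induction l with
  | nil => simp [AvoidsTriple]
  | cons a l ih =>
    rcases l with _ | ⟨b, _ | ⟨c, l⟩⟩
    · simp [AvoidsTriple]
    · simp [AvoidsTriple]
    · simp only [List.reverse_cons, List.append_assoc, AvoidsTriple, List.cons_append,
        List.nil_append] at ih ⊢
      rw [avoidsTriple_append_triple, ih, and_comm]

theorem rlMin_append_cons {B : List ℕ} {m : ℕ} {T : List ℕ} (hB : ∀ b ∈ B, m < b)
    (hT : ∀ t ∈ T, m < t) : rlMin (B ++ m :: T) = 1 + rlMin T := by
  induction B with
  | nil => simpa [rlMin] using hT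
  | cons a B ih =>
    have h : ¬ ∀ b ∈ B ++ m :: T, a < b := fun h => by
      have := h m (by simp)
      have := hB a (by simp)
      omega
    rw [List.cons_append, rlMin, if_neg h, ih fun b hb => hB b (by simp [hb]), zero_add]

theorem rlMin_of_pairwise_lt {l : List ℕ} (h : l.Pairwise (· < ·)) : rlMin l = l.length := by
  induction l with
  | nil => rfl
  | cons a l ih =>
    rw [List.pairwise_cons] at h
    rw [rlMin, if_pos h.1, ih h.2, List.length_cons, add_comm]

theorem append_cons_inj_of_lt {B B' σ σ' : List ℕ} {m m' : ℕ} (h : B ++ m :: σ = B' ++ m' :: σ')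
    (hB : ∀ b ∈ B, m < b) (hσ : ∀ b ∈ σ, m < b) (hB' : ∀ b ∈ B', m' < b)
    (hσ' : ∀ b ∈ σ', m' < b) : B = B' ∧ m = m' ∧ σ = σ' := by
  induction B generalizing B' with
  | nil =>
    cases B' with
    | nil => simpa using h
    | cons b B' =>
      obtain ⟨rfl, rfl⟩ := List.cons.inj h
      have := hσ m' (by simp)
      have := hB' m (by simp)
      omega
  | cons a B ih =>
    cases B' with
    | nil =>
      obtain ⟨rfl, rfl⟩ := List.cons.inj h
      have := hσ' m (by simp)
      have := hB a (by simp)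
      omega
    | cons b B' =>
      simp only [List.cons_append, List.cons.injEq] at h
      have := ih h.2 (fun b hb => hB b (by simp [hb])) (fun b hb => hB' b (by simp [hb]))
      simp [h.1, this]

theorem exists_min_mem {l : List ℕ} (hl : l ≠ []) :
    ∃ m ∈ l, ∀ b ∈ l, b ≠ m → m < b := by
  have hne : l.toFinset.Nonempty := by simpa using hl
  refine ⟨l.toFinset.min' hne, by simpa using l.toFinset.min'_mem hne, fun b hb hbm => ?_⟩
  exact lt_of_le_of_ne (l.toFinset.min'_le b (by simpa using hb)) hbm.symm

/-- `BlockReversal σ D τ`: cut `σ` after each of its right-to-left minima; `D` lists the blocks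
of size one in decreasing order, and `τ` is obtained from the remaining blocks by
reversing each of them except for its last letter. -/
inductive BlockReversal : List ℕ → List ℕ → List ℕ → Prop
  | nil : BlockReversal [] [] []
  | single {σ D τ : List ℕ} {m : ℕ} (h : BlockReversal σ D τ) (hσ : ∀ b ∈ σ, m < b) :
      BlockReversal (m :: σ) (D ++ [m]) τ
  | block {σ D τ B : List ℕ} {m : ℕ} (h : BlockReversal σ D τ) (hσ : ∀ b ∈ σ, m < b)
      (hB : ∀ b ∈ B, m < b) (hne : B ≠ []) :
      BlockReversal (B ++ m :: σ) D (B.reverse ++ m :: τ)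

namespace BlockReversal

theorem perm {σ D τ : List ℕ} (h : BlockReversal σ D τ) : σ.Perm (D ++ τ) := by
  induction h with
  | nil => rfl
  | single _ _ ih => grind
  | @block σ D τ B m _ _ _ _ ih =>
    rw [List.perm_iff_count] at ih ⊢
    intro a
    have := ih a
    simp only [List.count_append, List.count_cons, List.count_reverse] at this ⊢
    omega

theorem mem_iff {σ D τ : List ℕ} (h : BlockReversal σ D τ) (b : ℕ) : b ∈ σ ↔ b ∈ D ∨ b ∈ τ := by
  rw [h.perm.mem_iff, List.mem_append]

theorem forall_mem_iff {σ D τ : List ℕ} (h : BlockReversal σ D τ) {P : ℕ → Prop} :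
    (∀ b ∈ σ, P b) ↔ (∀ b ∈ D, P b) ∧ ∀ b ∈ τ, P b := by
  simp only [h.mem_iff, or_imp, forall_and]

theorem pairwise {σ D τ : List ℕ} (h : BlockReversal σ D τ) : D.Pairwise (· > ·) := by
  induction h with
  | nil => simp
  | @single σ D τ m h hσ ih =>
    rw [List.pairwise_append]
    exact ⟨ih, List.pairwise_singleton _ _, by simpa using (h.forall_mem_iff.1 hσ).1⟩
  | block _ _ _ _ ih => exact ih

theorem rlMin_eq {σ D τ : List ℕ} (h : BlockReversal σ D τ) :
    rlMin σ = D.length + rlMin τ := by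
  induction h with
  | nil => rfl
  | single h hσ ih =>
    rw [rlMin, if_pos hσ, ih, List.length_append, List.length_singleton]
    omega
  | block h hσ hB _ ih =>
    rw [rlMin_append_cons hB hσ, rlMin_append_cons (by simpa using hB) (h.forall_mem_iff.1 hσ).2, ih]
    omega

theorem adjCount_cons_congr {m m' : ℕ} {τ : List ℕ} (h : ∀ b ∈ τ, m < b) (h' : ∀ b ∈ τ, m' < b) :
    adjCount (· < ·) (m :: τ) = adjCount (· < ·) (m' :: τ) := by
  cases τ with
  | nil => rfl
  | cons a τ => simp [adjCount, h a, h' a]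

theorem adjCount_eq {σ D τ : List ℕ} (h : BlockReversal σ D τ) {x : ℕ} (hx : ∀ b ∈ σ, x < b) :
    adjCount (fun a b => b < a) σ = adjCount (· < ·) (x :: τ) := by
  induction h with
  | nil => rfl
  | @single σ D τ m h hσ ih =>
    rw [← ih (fun b hb => hx b (by simp [hb]))]
    cases σ with
    | nil => rfl
    | cons a σ => simp [adjCount, (hσ a (by simp)).le]
  | @block σ D τ B m h hσ hB hne ih =>
    have hx' : ∀ b ∈ σ, x < b := fun b hb => hx b (by simp [hb])
    have e1 : adjCount (fun a b => b < a) (m :: σ) = adjCount (fun a b => b < a) σ := by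
      cases σ with
      | nil => rfl
      | cons a σ => simp [adjCount, (hσ a (by simp)).le]
    have e2 : adjCount (· < ·) (x :: (B.reverse ++ [m])) =
        adjCount (fun a b => b < a) (B ++ [m]) := by
      have : x :: (B.reverse ++ [m]) = (m :: B ++ [x]).reverse := by simp
      rw [this, adjCount_reverse]
      obtain ⟨a, C, rfl⟩ := List.exists_cons_of_ne_nil hne
      rw [List.cons_append, List.cons_append, adjCount,
        if_neg (hB a (by simp)).not_gt, zero_add, ← List.cons_append]
      obtain ⟨C', b, hC⟩ := (List.eq_nil_or_concat' (a :: C)).resolve_left hne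
      rw [hC] at hB hx ⊢
      have e (y : ℕ) (hy : y < b) : adjCount (fun a b => b < a) (C' ++ [b] ++ [y]) =
          adjCount (fun a b => b < a) (C' ++ [b]) + 1 := by
        rw [List.append_assoc, List.singleton_append, adjCount_append_cons]
        simp [adjCount, hy]
      rw [e x (hx b (by simp)), e m (hB b (by simp))]
    rw [adjCount_append_cons, e1, ih hx', ← List.cons_append,
      adjCount_append_cons (· < ·), List.cons_append, e2]
    congr 1
    exact adjCount_cons_congr (h.forall_mem_iff.1 hx').2 (h.forall_mem_iff.1 hσ).2

theorem avoidsTriple_block {B : List ℕ} {m x : ℕ} (hne : B ≠ []) (hB : ∀ b ∈ B, m < b)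
    (hx : ∀ b ∈ B, x < b) :
    AvoidsTriple (fun a b c => a < b ∧ b < c) (x :: (B.reverse ++ [m])) ↔
      AvoidsTriple (fun a b c => c < b ∧ b < a) (B ++ [m]) := by
  have : x :: (B.reverse ++ [m]) = (m :: B ++ [x]).reverse := by simp
  rw [this, avoidsTriple_reverse]
  have h1 : AvoidsTriple (fun a b c => c < b ∧ b < a) (m :: B ++ [x]) ↔
      AvoidsTriple (fun a b c => c < b ∧ b < a) (B ++ [x]) := by
    rcases B with _ | ⟨a, _ | ⟨b, B⟩⟩
    · simp [AvoidsTriple]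
    · simp [AvoidsTriple, (hB a (by simp)).le]
    · simp [AvoidsTriple, (hB a (by simp)).le]
  rw [h1]
  rcases List.eq_nil_or_concat' B with rfl | ⟨C, b, rfl⟩
  · simp [AvoidsTriple]
  rcases List.eq_nil_or_concat' C with rfl | ⟨C, a, rfl⟩
  · simp [AvoidsTriple]
  simp only [List.append_assoc, List.cons_append, List.nil_append, avoidsTriple_append_triple]
  simp [hB b, hx b]

theorem avoidsTriple_cons_of_lt {m : ℕ} {σ : List ℕ} (hσ : ∀ b ∈ σ, m < b) :
    AvoidsTriple (fun a b c => c < b ∧ b < a) (m :: σ) ↔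
      AvoidsTriple (fun a b c => c < b ∧ b < a) σ := by
  rcases σ with _ | ⟨a, _ | ⟨b, σ⟩⟩
  · simp [AvoidsTriple]
  · simp [AvoidsTriple]
  · simp [AvoidsTriple, (hσ a (by simp)).le]

theorem avoidsTriple_cons_congr {m x : ℕ} {T : List ℕ} (h : ∀ b ∈ T, m < b)
    (h' : ∀ b ∈ T, x < b) :
    AvoidsTriple (fun a b c => a < b ∧ b < c) (m :: T) ↔
      AvoidsTriple (fun a b c => a < b ∧ b < c) (x :: T) := by
  rcases T with _ | ⟨a, _ | ⟨b, σ⟩⟩ <;> simp_all [AvoidsTriple]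

theorem avoidsTriple_cons_reverse_append {B T : List ℕ} {m x : ℕ} (hne : B ≠ [])
    (hB : ∀ b ∈ B, m < b) (hx : ∀ b ∈ B, x < b) (hT : ∀ b ∈ T, m < b) (hxT : ∀ b ∈ T, x < b) :
    AvoidsTriple (fun a b c => a < b ∧ b < c) (x :: (B.reverse ++ m :: T)) ↔
      AvoidsTriple (fun a b c => c < b ∧ b < a) (B ++ [m]) ∧
        AvoidsTriple (fun a b c => a < b ∧ b < c) (x :: T) := by
  rw [← avoidsTriple_cons_congr hT hxT, ← avoidsTriple_block hne hB hx]
  obtain ⟨a, C, rfl⟩ := List.exists_cons_of_ne_nil hne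
  have := avoidsTriple_append_cons_cons (p := fun a b c => a < b ∧ b < c) (x :: C.reverse)
    (b := a) (m := m) (T := T) (fun c _ h => absurd h.1 (hB a (by simp)).not_gt)
  simpa using this

theorem avoidsTriple_append_cons {B σ : List ℕ} {m : ℕ} (hB : ∀ b ∈ B, m < b)
    (hσ : ∀ b ∈ σ, m < b) :
    AvoidsTriple (fun a b c => c < b ∧ b < a) (B ++ m :: σ) ↔
      AvoidsTriple (fun a b c => c < b ∧ b < a) (B ++ [m]) ∧
        AvoidsTriple (fun a b c => c < b ∧ b < a) σ := by
  rw [← avoidsTriple_cons_of_lt hσ]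
  rcases List.eq_nil_or_concat' B with rfl | ⟨C, b, rfl⟩
  · simp [AvoidsTriple]
  have := avoidsTriple_append_cons_cons (p := fun a b c => c < b ∧ b < a) C
    (b := b) (m := m) (T := σ) (fun c hc h => absurd h.1 (hσ c hc).not_gt)
  simpa using this

theorem avoidsTriple_iff {σ D τ : List ℕ} (h : BlockReversal σ D τ) {x N : ℕ}
    (hx : ∀ b ∈ σ, x < b) (hN : ∀ b ∈ σ, b < N) (hxN : x < N) :
    AvoidsTriple (fun a b c => c < b ∧ b < a) σ ↔
      AvoidsTriple (fun a b c => a < b ∧ b < c) (x :: (τ ++ [N])) := by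
  induction h with
  | nil => simp [AvoidsTriple]
  | single h hσ ih =>
    rw [avoidsTriple_cons_of_lt hσ]
    exact ih (fun b hb => hx b (by simp [hb])) (fun b hb => hN b (by simp [hb]))
  | @block σ D τ B m h hσ hB hne ih =>
    simp only [List.forall_mem_append, List.forall_mem_cons] at hx hN
    rw [avoidsTriple_append_cons hB hσ, List.append_assoc, List.cons_append,
      avoidsTriple_cons_reverse_append hne hB hx.1, ih hx.2.2 hN.2.2]
    · exact List.forall_mem_append.2 ⟨(h.forall_mem_iff.1 hσ).2, by simpa using hN.2.1⟩
    · exact List.forall_mem_append.2 ⟨(h.forall_mem_iff.1 hx.2.2).2, by simpa using hxN⟩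

theorem cases_left {σ D τ : List ℕ} (h : BlockReversal σ D τ) :
    (σ = [] ∧ D = [] ∧ τ = []) ∨
    (∃ m σ' D', σ = m :: σ' ∧ D = D' ++ [m] ∧ BlockReversal σ' D' τ ∧ ∀ b ∈ σ', m < b) ∨
    (∃ B m σ' τ', σ = B ++ m :: σ' ∧ τ = B.reverse ++ m :: τ' ∧ BlockReversal σ' D τ' ∧
      (∀ b ∈ σ', m < b) ∧ (∀ b ∈ B, m < b) ∧ B ≠ []) := by
  cases h with
  | nil => simp
  | single h hσ => exact .inr (.inl ⟨_, _, _, rfl, rfl, h, hσ⟩)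
  | block h hσ hB hne => exact .inr (.inr ⟨_, _, _, _, rfl, rfl, h, hσ, hB, hne⟩)

theorem right_unique {σ D τ D' τ' : List ℕ} (h : BlockReversal σ D τ)
    (h' : BlockReversal σ D' τ') : D = D' ∧ τ = τ' := by
  induction h generalizing D' τ' with
  | nil => rcases h'.cases_left with h' | ⟨_, _, _, h', _⟩ | ⟨_, _, _, _, h', _⟩ <;> simp_all
  | @single σ D τ m h hσ ih =>
    rcases h'.cases_left with h' | ⟨m', σ', E, h1, rfl, h2, h3⟩ |
      ⟨B, m', σ', τ', h1, rfl, h2, h3, h4, h5⟩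
    · simp at h'
    · obtain ⟨rfl, rfl⟩ := List.cons.inj h1
      simpa using ih h2
    · have := append_cons_inj_of_lt (B := []) h1 (by simp) hσ h4 h3
      exact absurd this.1.symm h5
  | @block σ D τ B m h hσ hB hne ih =>
    rcases h'.cases_left with h' | ⟨m', σ', E, h1, rfl, h2, h3⟩ |
      ⟨B, m', σ', τ', h1, rfl, h2, h3, h4, h5⟩
    · simp at h'
    · have := append_cons_inj_of_lt (B' := []) h1 hB hσ (by simp) h3
      exact absurd this.1 hne
    · obtain ⟨rfl, rfl, rfl⟩ := append_cons_inj_of_lt h1 hB hσ h4 h3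
      simpa using ih h2

theorem left_unique {σ σ' D τ : List ℕ} (h : BlockReversal σ D τ)
    (h' : BlockReversal σ' D τ) : σ = σ' := by
  induction h generalizing σ' with
  | nil =>
    rcases h'.cases_left with h' | ⟨_, _, _, _, h', _⟩ | ⟨_, _, _, _, _, h', _⟩
    · exact h'.1.symm
    · simp at h'
    · simp at h'
  | @single σ D τ m h hσ ih =>
    rcases h'.cases_left with h' | ⟨m', σ', E, rfl, h1, h2, h3⟩ |
      ⟨B, m', σ', τ', rfl, h1, h2, h3, h4, h5⟩
    · simp at h'
    · obtain ⟨rfl, h4⟩ := List.append_inj' h1 rfl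
      obtain rfl : m = m' := by simpa using h4
      rw [ih h2]
    · have := h3 m ((h2.mem_iff m).2 (by simp))
      have := hσ m' ((h.mem_iff m').2 (by simp [h1]))
      omega
  | @block σ D τ B m h hσ hB hne ih =>
    rcases h'.cases_left with h' | ⟨m', σ', E, rfl, h1, h2, h3⟩ |
      ⟨B, m', σ', τ', rfl, h1, h2, h3, h4, h5⟩
    · simp at h'
    · have := hσ m' ((h.mem_iff m').2 (by simp [h1]))
      have := h3 m ((h2.mem_iff m).2 (by simp))
      omega
    · obtain ⟨h6, rfl, rfl⟩ := append_cons_inj_of_lt h1 (by simpa using hB)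
        (h.forall_mem_iff.1 hσ).2 (by simpa using h4) (h2.forall_mem_iff.1 h3).2
      rw [List.reverse_injective h6, ih h2]

theorem _root_.List.Nodup.exists_append_cons_min {l : List ℕ} (hn : l.Nodup) (hne : l ≠ []) :
    ∃ B m T, l = B ++ m :: T ∧ (∀ b ∈ B, m < b) ∧ ∀ b ∈ T, m < b := by
  obtain ⟨m, hm, hmin⟩ := exists_min_mem hne
  obtain ⟨B, T, rfl⟩ := List.append_of_mem hm
  simp only [List.nodup_append, List.nodup_cons, List.mem_cons] at hn
  refine ⟨B, m, T, rfl, fun b hb => hmin b (by simp [hb]) (hn.2.2 b hb m (by simp)),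
    fun b hb => hmin b (by simp [hb]) ?_⟩
  rintro rfl
  exact hn.2.1.1 hb

theorem exists_of_nodup {σ : List ℕ} (hσ : σ.Nodup) : ∃ D τ, BlockReversal σ D τ := by
  induction hk : σ.length using Nat.strong_induction_on generalizing σ with
  | _ k ih =>
    rcases eq_or_ne σ [] with rfl | hne
    · exact ⟨[], [], .nil⟩
    obtain ⟨B, m, σ', rfl, h2, h1⟩ := hσ.exists_append_cons_min hne
    simp only [List.length_append, List.length_cons] at hk
    obtain ⟨D, τ, h⟩ := ih σ'.length (by omega) hσ.of_append_right.of_cons rfl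
    rcases eq_or_ne B [] with rfl | hB
    · exact ⟨_, _, h.single h1⟩
    · exact ⟨_, _, h.block h1 h2 hB⟩

theorem exists_of_avoidsTriple {D τ : List ℕ} {x N : ℕ} (hn : (D ++ τ).Nodup)
    (hD : D.Pairwise (· > ·)) (hx : ∀ b ∈ D ++ τ, x < b) (hN : ∀ b ∈ D ++ τ, b < N) (hxN : x < N)
    (hτ : AvoidsTriple (fun a b c => a < b ∧ b < c) (x :: (τ ++ [N]))) :
    ∃ σ, BlockReversal σ D τ := by
  induction hk : D.length + τ.length using Nat.strong_induction_on generalizing D τ with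
  | _ k ih =>
    rcases eq_or_ne (D ++ τ) [] with h0 | hne
    · obtain ⟨rfl, rfl⟩ := List.append_eq_nil_iff.1 h0
      exact ⟨[], .nil⟩
    obtain ⟨B, m, T, hBT, hB, hT⟩ := hn.exists_append_cons_min hne
    have hmem : m ∈ D ++ τ := by simp [hBT]
    have hmin : ∀ b ∈ D ++ τ, m ≤ b := by
      rw [hBT]
      simp only [List.forall_mem_append, List.forall_mem_cons]
      exact ⟨fun b hb => (hB b hb).le, le_rfl, fun b hb => (hT b hb).le⟩
    have hxm := hx m hmem
    have hmN := hN m hmem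
    simp only [List.forall_mem_append] at hx hN hmin
    have hlt {C : List ℕ} (h : ∀ b ∈ C, m ≤ b) (h' : m ∉ C) : ∀ b ∈ C, m < b := fun b hb =>
      lt_of_le_of_ne (h b hb) fun e => h' (e ▸ hb)
    clear hBT hB hT B T
    rcases List.mem_append.1 hmem with hm | hm
    · obtain ⟨E, t, rfl⟩ := List.append_of_mem hm
      obtain rfl : t = [] := by
        rcases t with _ | ⟨a, t⟩
        · rfl
        · have := hmin.1 a (by simp)
          simp only [List.pairwise_append, List.pairwise_cons] at hD
          have := hD.2.1.1 a (by simp)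
          omega
      simp only [List.forall_mem_append] at hx hN hmin
      simp only [List.length_append, List.length_cons] at hk
      have hn' := hn
      simp only [List.append_assoc, List.singleton_append, List.nodup_middle, List.nodup_cons,
        List.mem_append, not_or] at hn'
      obtain ⟨σ, h⟩ := ih (E.length + τ.length) (by omega) hn'.2 (List.pairwise_append.1 hD).1
        (by simp only [List.forall_mem_append]; exact ⟨hx.1.1, hx.2⟩)
        (by simp only [List.forall_mem_append]; exact ⟨hN.1.1, hN.2⟩) hτ rfl
      exact ⟨_, h.single (h.forall_mem_iff.2 ⟨hlt hmin.1.1 hn'.1.1, hlt hmin.2 hn'.1.2⟩)⟩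
    · obtain ⟨B, τ', rfl⟩ := List.append_of_mem hm
      simp only [List.length_append, List.length_cons] at hk
      simp only [List.forall_mem_append, List.forall_mem_cons] at hx hN hmin
      rw [← List.append_assoc, List.nodup_middle, List.nodup_cons] at hn
      simp only [List.mem_append, not_or] at hn
      have hB := hlt hmin.2.1 hn.1.1.2
      have hτ' := hlt hmin.2.2.2 hn.1.2
      have hBr : B.reverse ≠ [] := by
        rw [ne_eq, List.reverse_eq_nil_iff]
        rintro rfl
        rcases τ' with _ | ⟨a, τ'⟩
        · simp only [AvoidsTriple, List.nil_append, List.cons_append] at hτ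
          exact hτ.1 ⟨hxm, hmN⟩
        · simp only [AvoidsTriple, List.nil_append, List.cons_append] at hτ
          exact hτ.1 ⟨hxm, hτ' a (by simp)⟩
      have h3 := avoidsTriple_cons_reverse_append (B := B.reverse) (m := m) (x := x)
        (T := τ' ++ [N]) hBr (by simpa using hB) (by simpa using hx.2.1)
        (List.forall_mem_append.2 ⟨hτ', by simpa using hmN⟩)
        (List.forall_mem_append.2 ⟨hx.2.2.2, by simpa using hxN⟩)
      rw [List.reverse_reverse] at h3
      rw [List.append_assoc, List.cons_append, h3] at hτ
      obtain ⟨σ, h⟩ := ih (D.length + τ'.length) (by omega)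
        (hn.2.sublist (by simp)) hD
        (by simp only [List.forall_mem_append]; exact ⟨hx.1, hx.2.2.2⟩)
        (by simp only [List.forall_mem_append]; exact ⟨hN.1, hN.2.2.2⟩) hτ.2 rfl
      have h4 := h.block (m := m) (B := B.reverse)
        (h.forall_mem_iff.2 ⟨hlt hmin.1 hn.1.1.1, hτ'⟩) (by simpa using hB) hBr
      exact ⟨_, by simpa using h4⟩

end BlockReversal

theorem card_filter_Icc_one (n : ℕ) (P : ℕ → Prop) [DecidablePred P] :
    ((Finset.Icc 1 n).filter P).card = ∑ i ∈ Finset.range n, if P (i + 1) then 1 else 0 := by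
  rw [Finset.card_filter, Finset.range_eq_Ico, Finset.sum_Ico_add' (fun i => if P i then 1 else 0)]
  rfl

theorem wB_succ {w : List ℕ} {i : ℕ} (h : i < w.length) : wB w (i + 1) = w.getD i 0 := by
  simp [wB, h]

theorem wB_succ_eq_append {w : List ℕ} {i : ℕ} (h : i ≤ w.length) :
    wB w (i + 1) = (w ++ [w.length + 1]).getD i 0 := by
  rcases h.lt_or_eq with h | rfl
  · rw [wB_succ h, List.getD_append _ _ _ _ h]
  · simp [wB]

theorem adjCount_eq_sum (p : ℕ → ℕ → Prop) [DecidableRel p] (l : List ℕ) :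
    adjCount p l =
      ∑ i ∈ Finset.range (l.length - 1), if p (l.getD i 0) (l.getD (i + 1) 0) then 1 else 0 := by
  induction l with
  | nil => simp [adjCount]
  | cons a l ih =>
    cases l with
    | nil => simp [adjCount]
    | cons b l =>
      rw [adjCount, ih]
      simp only [List.length_cons, Nat.add_sub_cancel]
      rw [Finset.sum_range_succ', add_comm]
      rfl

theorem desW_eq_adjCount (w : List ℕ) : desW w = adjCount (fun a b => b < a) w := by
  rw [desW, card_filter_Icc_one, adjCount_eq_sum]
  refine Finset.sum_congr rfl fun i hi => ?_
  have := Finset.mem_range.1 hi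
  rw [wB_succ (by omega), wB_succ (by omega)]

theorem ascW_eq_adjCount (w : List ℕ) : ascW w = adjCount (· < ·) w := by
  rw [ascW, card_filter_Icc_one, adjCount_eq_sum]
  refine Finset.sum_congr rfl fun i hi => ?_
  have := Finset.mem_range.1 hi
  rw [wB_succ (by omega), wB_succ (by omega)]

theorem avoidsTriple_iff_getD {p : ℕ → ℕ → ℕ → Prop} (l : List ℕ) :
    AvoidsTriple p l ↔
      ∀ i, i + 2 < l.length → ¬ p (l.getD i 0) (l.getD (i + 1) 0) (l.getD (i + 2) 0) := by
  induction l with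
  | nil => simp [AvoidsTriple]
  | cons a l ih =>
    rcases l with _ | ⟨b, _ | ⟨c, l⟩⟩
    · simp [AvoidsTriple]
    · simp [AvoidsTriple]
    · rw [AvoidsTriple, ih]
      refine ⟨fun h i hi => ?_, fun h => ⟨h 0 (by simp), fun i hi => h (i + 1) ?_⟩⟩
      · cases i with
        | zero => exact h.1
        | succ i => exact h.2 i (by simpa using hi)
      · simpa using hi

theorem noInternalDD_iff (w : List ℕ) :
    noInternalDD w ↔ AvoidsTriple (fun a b c => c < b ∧ b < a) w := by
  rw [avoidsTriple_iff_getD]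
  refine ⟨fun h i hi => ?_, fun h i hi => ?_⟩
  · have := h (i + 2) (Finset.mem_Icc.2 ⟨by omega, by omega⟩)
    rwa [wB_succ (by omega), wB_succ (by omega), show i + 2 - 1 = i + 1 from rfl,
      wB_succ (by omega)] at this
  · obtain ⟨h1, h2⟩ := Finset.mem_Icc.1 hi
    obtain ⟨i, rfl⟩ := Nat.exists_eq_add_of_le' h1
    rw [wB_succ (by omega), wB_succ (by omega), show i + 2 - 1 = i + 1 from rfl,
      wB_succ (by omega)]
    exact h i (by omega)

theorem daW_eq_zero_iff {w : List ℕ} (hw : ∀ b ∈ w, b ≤ w.length) :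
    daW w = 0 ↔ AvoidsTriple (fun a b c => a < b ∧ b < c) (w ++ [w.length + 1]) := by
  rw [daW, Finset.card_eq_zero, Finset.filter_eq_empty_iff, avoidsTriple_iff_getD,
    List.length_append, List.length_singleton]
  refine ⟨fun h i hi => ?_, fun h i hi => ?_⟩
  · have := h (x := i + 2) (Finset.mem_Icc.2 ⟨by omega, by omega⟩)
    rwa [isDAat, wB_succ_eq_append (by omega), wB_succ_eq_append (by omega),
      show i + 2 - 1 = i + 1 from rfl, wB_succ_eq_append (by omega)] at this
  · obtain ⟨h1, h2⟩ := Finset.mem_Icc.1 hi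
    rcases h1.eq_or_lt with rfl | h1
    · rintro ⟨h3, -⟩
      have h4 : wB w 1 ≤ w.length := by
        rw [wB_succ (by omega), List.getD_eq_getElem _ _ (by omega)]
        exact hw _ (List.getElem_mem _)
      have h5 : wB w (1 - 1) = w.length + 1 := by simp [wB]
      omega
    · obtain ⟨i, rfl⟩ := Nat.exists_eq_add_of_le' (show 2 ≤ i from h1)
      rw [isDAat, wB_succ_eq_append (by omega), wB_succ_eq_append (by omega),
        show i + 2 - 1 = i + 1 from rfl, wB_succ_eq_append (by omega)]
      exact h i (by omega)

theorem rlMin_eq_sum (l : List ℕ) :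
    rlMin l = ∑ i ∈ Finset.range l.length,
      if ∀ j < l.length, i < j → l.getD i 0 < l.getD j 0 then 1 else 0 := by
  induction l with
  | nil => rfl
  | cons a l ih =>
    rw [rlMin, ih, List.length_cons, Finset.sum_range_succ', add_comm]
    congr 1
    · refine Finset.sum_congr rfl fun i _ => if_congr ?_ rfl rfl
      refine ⟨fun h j hj hij => ?_, fun h j hj hij => ?_⟩
      · obtain ⟨j, rfl⟩ := Nat.exists_eq_succ_of_ne_zero (show j ≠ 0 by omega)
        exact h j (by omega) (by omega)
      · exact h (j + 1) (by omega) (by omega)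
    · refine if_congr ⟨fun h j hj h0 => ?_, fun h b hb => ?_⟩ rfl rfl
      · obtain ⟨j, rfl⟩ := Nat.exists_eq_succ_of_ne_zero (show j ≠ 0 by omega)
        rw [List.getD_cons_zero, List.getD_cons_succ, List.getD_eq_getElem _ _ (by omega)]
        exact h _ (List.getElem_mem _)
      · obtain ⟨j, hj, rfl⟩ := List.getElem_of_mem hb
        have := h (j + 1) (by omega) (by omega)
        rwa [List.getD_cons_zero, List.getD_cons_succ, List.getD_eq_getElem _ _ hj] at this

theorem rlminW_eq_rlMin (w : List ℕ) : rlminW w = rlMin w := by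
  rw [rlminW, card_filter_Icc_one, rlMin_eq_sum]
  refine Finset.sum_congr rfl fun i hi => if_congr ?_ rfl rfl
  have hi := Finset.mem_range.1 hi
  refine ⟨fun h j hj hij => ?_, fun h j hj => ?_⟩
  · have := h (j + 1) (Finset.mem_Icc.2 ⟨by omega, by omega⟩)
    rwa [wB_succ hi, wB_succ hj] at this
  · obtain ⟨h1, h2⟩ := Finset.mem_Icc.1 hj
    obtain ⟨j, rfl⟩ := Nat.exists_eq_succ_of_ne_zero (show j ≠ 0 by omega)
    rw [wB_succ hi, wB_succ (by omega)]
    exact h j (by omega) (by omega)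

theorem lrminW_eq_sum (w : List ℕ) :
    lrminW w = ∑ i ∈ Finset.range w.length,
      if ∀ j < i, w.getD i 0 < w.getD j 0 then 1 else 0 := by
  rw [lrminW, card_filter_Icc_one]
  refine Finset.sum_congr rfl fun i hi => if_congr ?_ rfl rfl
  have hi := Finset.mem_range.1 hi
  refine ⟨fun h j hj => ?_, fun h j hj => ?_⟩
  · have := h (j + 1) (Finset.mem_Icc.2 ⟨by omega, by omega⟩)
    rwa [wB_succ hi, wB_succ (by omega)] at this
  · obtain ⟨h1, h2⟩ := Finset.mem_Icc.1 hj
    obtain ⟨j, rfl⟩ := Nat.exists_eq_succ_of_ne_zero (show j ≠ 0 by omega)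
    rw [wB_succ hi, wB_succ (by omega)]
    exact h j (by omega)

theorem lrminW_eq_rlMin_reverse (w : List ℕ) : lrminW w = rlMin w.reverse := by
  rw [lrminW_eq_sum]
  induction w using List.reverseRecOn with
  | nil => rfl
  | append_singleton w a ih =>
    rw [List.reverse_append, List.reverse_singleton, List.singleton_append, rlMin, ← ih,
      List.length_append, List.length_singleton, Finset.sum_range_succ, add_comm]
    congr 1
    · refine if_congr ⟨fun h b hb => ?_, fun h j hj => ?_⟩ rfl rfl
      · obtain ⟨j, hj, rfl⟩ := List.getElem_of_mem (List.mem_reverse.1 hb)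
        have := h j hj
        rwa [List.getD_append _ _ _ _ hj, List.getD_eq_getElem _ _ hj, List.getD_append_right _ _ _ _ le_rfl,
          Nat.sub_self, List.getD_cons_zero] at this
      · rw [List.getD_append _ _ _ _ hj, List.getD_eq_getElem _ _ hj, List.getD_append_right _ _ _ _ le_rfl,
          Nat.sub_self, List.getD_cons_zero]
        exact h w[j] (by simp)
    · refine Finset.sum_congr rfl fun i hi => if_congr ?_ rfl rfl
      have hi := Finset.mem_range.1 hi
      refine forall₂_congr fun j hj => ?_
      rw [List.getD_append _ _ _ _ hi, List.getD_append _ _ _ _ (hj.trans hi)]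

theorem wB_cons_succ_succ (a : ℕ) {w : List ℕ} {i : ℕ} (h : i < w.length) :
    wB (a :: w) (i + 1 + 1) = wB w (i + 1) := by
  rw [wB_succ h, wB_succ (by simpa using h)]
  rfl

theorem isPRW_cons_cons (a b : ℕ) (l : List ℕ) :
    isPRW (a :: b :: l) ↔ (a < b → a = 1) ∧ (¬ a < b → isPRW (b :: l)) := by
  have e1 : wB (a :: b :: l) 1 = a := by simp [wB]
  have e2 : wB (a :: b :: l) (1 + 1) = b := by simp [wB]
  refine ⟨fun h => ⟨fun hab => ?_, fun hab i hi hlt hj => ?_⟩, fun h i hi hlt hj => ?_⟩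
  · simpa only [e1] using h 1 (by simp) (by rwa [e1, e2]) (by simp)
  · obtain ⟨h1, h2⟩ := Finset.mem_Icc.1 hi
    obtain ⟨i, rfl⟩ := Nat.exists_eq_succ_of_ne_zero (show i ≠ 0 by omega)
    simp only [List.length_cons, Nat.add_sub_cancel] at h2
    rw [← wB_cons_succ_succ a (by simp; omega)]
    refine h (i + 1 + 1) (by simp; omega) ?_ fun j hj' => ?_
    · rwa [wB_cons_succ_succ a (by simp; omega), wB_cons_succ_succ a (by simp; omega)]
    · obtain ⟨h3, h4⟩ := Finset.mem_Icc.1 hj'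
      obtain ⟨j, rfl⟩ := Nat.exists_eq_succ_of_ne_zero (show j ≠ 0 by omega)
      rcases Nat.eq_zero_or_pos j with rfl | h0
      · simpa only [Nat.succ_eq_add_one, zero_add, e1, e2] using hab
      · obtain ⟨j, rfl⟩ := Nat.exists_eq_succ_of_ne_zero h0.ne'
        rw [Nat.succ_eq_add_one, wB_cons_succ_succ a (by simp; omega),
          wB_cons_succ_succ a (by simp; omega)]
        exact hj (j + 1) (Finset.mem_Icc.2 ⟨by omega, by omega⟩)
  · obtain ⟨h1, h2⟩ := Finset.mem_Icc.1 hi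
    simp only [List.length_cons, Nat.add_sub_cancel] at h2
    rcases h1.eq_or_lt with rfl | h1
    · rw [e1, e2] at hlt
      rw [e1, h.1 hlt]
    · obtain ⟨i, rfl⟩ := Nat.exists_eq_add_of_le' (show 2 ≤ i from h1)
      have hab : ¬ a < b := by
        have := hj 1 (Finset.mem_Icc.2 ⟨by omega, by omega⟩)
        rwa [e1, e2] at this
      rw [wB_cons_succ_succ a (by simp; omega), wB_cons_succ_succ a (by simp; omega)] at hlt
      rw [wB_cons_succ_succ a (by simp; omega)]
      refine h.2 hab (i + 1) (by simp; omega) hlt fun j hj' => ?_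
      obtain ⟨h3, h4⟩ := Finset.mem_Icc.1 hj'
      obtain ⟨j, rfl⟩ := Nat.exists_eq_succ_of_ne_zero (show j ≠ 0 by omega)
      have := hj (j + 1 + 1) (Finset.mem_Icc.2 ⟨by omega, by omega⟩)
      rwa [wB_cons_succ_succ a (by simp; omega), wB_cons_succ_succ a (by simp; omega)] at this

theorem isPRW_singleton (a : ℕ) : isPRW [a] := by simp [isPRW]

theorem isPRW_append_one_cons {D τ : List ℕ} (hn : D.Nodup) (hD : ∀ b ∈ D, 1 < b)
    (hτ : ∀ b ∈ τ, 1 < b) : isPRW (D ++ 1 :: τ) ↔ D.Pairwise (· > ·) := by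
  have h1 : isPRW (1 :: τ) := by
    cases τ with
    | nil => exact isPRW_singleton 1
    | cons b τ =>
      have := hτ b (by simp)
      exact (isPRW_cons_cons 1 b τ).2 ⟨fun _ => rfl, fun h => absurd this h⟩
  rw [← List.isChain_iff_pairwise]
  induction D with
  | nil => simpa using h1
  | cons a D ih =>
    have ha := hD a (by simp)
    have ih := ih hn.of_cons (fun b hb => hD b (by simp [hb]))
    cases D with
    | nil =>
      simp only [List.isChain_singleton, iff_true]
      exact (isPRW_cons_cons a 1 τ).2 ⟨by omega, fun _ => h1⟩
    | cons b D =>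
      have hab : a ≠ b := by rintro rfl; simp at hn
      refine Iff.trans ?_ (List.isChain_cons_cons.trans (and_congr_right fun _ => ih.symm)).symm
      refine (isPRW_cons_cons a b _).trans ?_
      constructor
      · rintro ⟨h2, h3⟩
        have : ¬ a < b := fun h => by have := h2 h; omega
        exact ⟨by omega, h3 this⟩
      · rintro ⟨h2, h3⟩
        exact ⟨by omega, fun _ => h3⟩

theorem adjCount_append_one_cons {D : List ℕ} (τ : List ℕ) (h : D.Pairwise (· > ·))
    (hD : ∀ b ∈ D, 1 < b) : adjCount (· < ·) (D ++ 1 :: τ) = adjCount (· < ·) (1 :: τ) := by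
  induction D with
  | nil => rfl
  | cons a D ih =>
    have ih := ih h.of_cons (fun b hb => hD b (by simp [hb]))
    cases D with
    | nil =>
      have h1 : ¬ a < 1 := (hD a (by simp)).not_gt
      rw [List.singleton_append, adjCount, if_neg h1, zero_add]
    | cons b D =>
      have hab : b < a := (List.pairwise_cons.1 h).1 b (by simp)
      rw [← ih, List.cons_append, List.cons_append, adjCount, if_neg hab.not_gt, zero_add]

theorem avoidsTriple_append_one_cons {D : List ℕ} (T : List ℕ) (h : D.Pairwise (· > ·))
    (hD : ∀ b ∈ D, 1 < b) : AvoidsTriple (fun a b c => a < b ∧ b < c) (D ++ 1 :: T) ↔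
      AvoidsTriple (fun a b c => a < b ∧ b < c) (1 :: T) := by
  induction D with
  | nil => rfl
  | cons a D ih =>
    rw [← ih h.of_cons (fun b hb => hD b (by simp [hb]))]
    have h1 := hD a (by simp)
    have h2 (b : ℕ) (hb : b ∈ D) : b < a := (List.pairwise_cons.1 h).1 b hb
    rcases D with _ | ⟨b, _ | ⟨c, D⟩⟩
    · cases T with
      | nil => simp [AvoidsTriple]
      | cons t T =>
        rw [List.nil_append, List.singleton_append, AvoidsTriple,
          and_iff_right fun h : a < 1 ∧ 1 < t => absurd h.1 h1.not_gt]
    · simp [AvoidsTriple, (h2 b (by simp)).le]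
    · simp [AvoidsTriple, (h2 b (by simp)).le]

theorem adjCount_map_succ (l : List ℕ) :
    adjCount (fun a b => b < a) (l.map (· + 1)) = adjCount (fun a b => b < a) l := by
  induction l with
  | nil => rfl
  | cons a l ih => cases l <;> simp_all [adjCount]

theorem rlMin_map_succ (l : List ℕ) : rlMin (l.map (· + 1)) = rlMin l := by
  induction l with
  | nil => rfl
  | cons a l ih => simp [rlMin, ih]

theorem avoidsTriple_map_succ (l : List ℕ) :
    AvoidsTriple (fun a b c => c < b ∧ b < a) (l.map (· + 1)) ↔
      AvoidsTriple (fun a b c => c < b ∧ b < a) l := by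
  induction l with
  | nil => rfl
  | cons a l ih => rcases l with _ | ⟨b, _ | ⟨c, l⟩⟩ <;> simp_all [AvoidsTriple]

theorem nodup_word {n : ℕ} (σ : Equiv.Perm (Fin n)) : (word σ).Nodup :=
  List.nodup_ofFn.2 fun i j h => σ.injective (Fin.ext (by simpa using h))

theorem mem_word {n : ℕ} (σ : Equiv.Perm (Fin n)) (b : ℕ) : b ∈ word σ ↔ 1 ≤ b ∧ b ≤ n := by
  rw [word, List.mem_ofFn]
  constructor
  · rintro ⟨i, rfl⟩
    have := (σ i).2
    omega
  · rintro ⟨h1, h2⟩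
    exact ⟨σ.symm ⟨b - 1, by omega⟩, by simp; omega⟩

theorem word_injective {n : ℕ} : Function.Injective (word (n := n)) := fun σ τ h =>
  Equiv.ext fun i => Fin.ext (by simpa using congrFun (List.ofFn_injective h) i)

theorem exists_word_eq {n : ℕ} {w : List ℕ} (hn : w.Nodup) (hw : ∀ b, b ∈ w ↔ 1 ≤ b ∧ b ≤ n) :
    ∃ σ : Equiv.Perm (Fin n), word σ = w := by
  have hlen : w.length = n := by
    rw [← List.toFinset_card_of_nodup hn, show w.toFinset = Finset.Icc 1 n by ext b; simp [hw]]
    simp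
  have hmem (i : Fin n) : 1 ≤ w[i] ∧ w[i] ≤ n := (hw _).1 (List.getElem_mem _)
  let f (i : Fin n) : Fin n := ⟨w[i] - 1, by have := hmem i; omega⟩
  have hf : Function.Injective f := fun i j h => by
    have h1 : w[i] - 1 = w[j] - 1 := congrArg Fin.val h
    have h2 := hmem i
    have h3 := hmem j
    have h4 : w[(i : ℕ)] = w[(j : ℕ)] := by simp only [Fin.getElem_fin] at h1 h2 h3; omega
    exact Fin.ext ((hn.getElem_inj_iff).1 h4)
  refine ⟨Equiv.ofBijective f (Finite.injective_iff_bijective.1 hf), ?_⟩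
  refine List.ext_getElem (by simp [word, hlen]) fun i h1 h2 => ?_
  have := hmem ⟨i, by omega⟩
  simp only [word, List.getElem_ofFn, Equiv.ofBijective_apply, f, Fin.getElem_fin] at this ⊢
  omega

/-- `σ ∈ S_n` and `ρ ∈ S_{n+1}` correspond if `ρ = D 1 τ`, where `D` and `τ` are obtained by
block reversal from the word of `σ` with all its letters increased by one. -/
def Corresponds {n : ℕ} (σ : Equiv.Perm (Fin n)) (ρ : Equiv.Perm (Fin (n + 1))) : Prop :=
  ∃ D τ, BlockReversal ((word σ).map (· + 1)) D τ ∧ word ρ = D ++ 1 :: τ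

theorem mem_map_succ_word {n : ℕ} (σ : Equiv.Perm (Fin n)) (b : ℕ) :
    b ∈ (word σ).map (· + 1) ↔ 1 < b ∧ b < n + 2 := by
  simp only [List.mem_map, mem_word]
  exact ⟨by rintro ⟨a, h, rfl⟩; omega, fun h => ⟨b - 1, by omega, by omega⟩⟩

theorem nodup_map_succ_word {n : ℕ} (σ : Equiv.Perm (Fin n)) : ((word σ).map (· + 1)).Nodup :=
  (nodup_word σ).map (add_left_injective 1)

theorem length_word {n : ℕ} (σ : Equiv.Perm (Fin n)) : (word σ).length = n := by simp [word]

namespace Corresponds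

variable {n : ℕ}

theorem isPRW_word {σ : Equiv.Perm (Fin n)} {ρ : Equiv.Perm (Fin (n + 1))}
    (h : Corresponds σ ρ) : isPRW (word ρ) := by
  obtain ⟨D, τ, h, hρ⟩ := h
  have h1 := h.forall_mem_iff.1 fun b hb => ((mem_map_succ_word σ b).1 hb).1
  rw [hρ]
  exact (isPRW_append_one_cons (h.pairwise.imp fun h => h.ne') h1.1 h1.2).2 h.pairwise

theorem ascW_word {σ : Equiv.Perm (Fin n)} {ρ : Equiv.Perm (Fin (n + 1))}
    (h : Corresponds σ ρ) : ascW (word ρ) = desW (word σ) := by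
  obtain ⟨D, τ, h, hρ⟩ := h
  have hσ : ∀ b ∈ (word σ).map (· + 1), 1 < b := fun b hb => ((mem_map_succ_word σ b).1 hb).1
  rw [ascW_eq_adjCount, hρ, adjCount_append_one_cons τ h.pairwise (h.forall_mem_iff.1 hσ).1,
    ← h.adjCount_eq hσ, adjCount_map_succ, desW_eq_adjCount]

theorem daW_word_eq_zero_iff {σ : Equiv.Perm (Fin n)} {ρ : Equiv.Perm (Fin (n + 1))}
    (h : Corresponds σ ρ) : daW (word ρ) = 0 ↔ noInternalDD (word σ) := by
  obtain ⟨D, τ, h, hρ⟩ := h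
  have hσ : ∀ b ∈ (word σ).map (· + 1), 1 < b := fun b hb => ((mem_map_succ_word σ b).1 hb).1
  have hσ' : ∀ b ∈ (word σ).map (· + 1), b < n + 2 :=
    fun b hb => ((mem_map_succ_word σ b).1 hb).2
  rw [daW_eq_zero_iff fun b hb => by rw [length_word]; exact ((mem_word ρ b).1 hb).2,
    length_word, hρ, List.append_assoc, List.cons_append,
    avoidsTriple_append_one_cons _ h.pairwise (h.forall_mem_iff.1 hσ).1,
    ← h.avoidsTriple_iff hσ hσ' (by omega), avoidsTriple_map_succ, noInternalDD_iff]

theorem lrminW_add_rlminW_word {σ : Equiv.Perm (Fin n)} {ρ : Equiv.Perm (Fin (n + 1))}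
    (h : Corresponds σ ρ) : lrminW (word ρ) + rlminW (word ρ) = rlminW (word σ) + 2 := by
  obtain ⟨D, τ, h, hρ⟩ := h
  have h1 := h.forall_mem_iff.1 fun b hb => ((mem_map_succ_word σ b).1 hb).1
  have hD : rlMin D.reverse = D.length := by
    rw [rlMin_of_pairwise_lt (List.pairwise_reverse.2 h.pairwise), List.length_reverse]
  rw [lrminW_eq_rlMin_reverse, rlminW_eq_rlMin, rlminW_eq_rlMin, ← rlMin_map_succ (word σ),
    h.rlMin_eq, hρ, rlMin_append_cons h1.1 h1.2, List.reverse_append, List.reverse_cons,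
    List.append_assoc, List.singleton_append,
    rlMin_append_cons (by simpa using h1.2) (by simpa using h1.1), hD]
  omega

theorem exists_right (σ : Equiv.Perm (Fin n)) : ∃ ρ, Corresponds σ ρ := by
  obtain ⟨D, τ, h⟩ := BlockReversal.exists_of_nodup (nodup_map_succ_word σ)
  have hmem (b : ℕ) : b ∈ D ∨ b ∈ τ ↔ 1 < b ∧ b < n + 2 := by
    rw [← h.mem_iff, mem_map_succ_word]
  obtain ⟨ρ, hρ⟩ := exists_word_eq (n := n + 1) (w := D ++ 1 :: τ)
    (by
      rw [List.nodup_middle, List.nodup_cons, List.mem_append, hmem]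
      exact ⟨by omega, h.perm.nodup (nodup_map_succ_word σ)⟩)
    (fun b => by
      rw [List.mem_append, List.mem_cons, or_left_comm, hmem]
      omega)
  exact ⟨ρ, D, τ, h, hρ⟩

theorem exists_left {ρ : Equiv.Perm (Fin (n + 1))} (h1 : isPRW (word ρ)) (h2 : daW (word ρ) = 0) :
    ∃ σ, Corresponds σ ρ := by
  obtain ⟨D, τ, hρ⟩ := List.append_of_mem ((mem_word ρ 1).2 ⟨le_rfl, by omega⟩)
  have hn := nodup_word ρ
  have hmem := mem_word ρ
  rw [daW_eq_zero_iff fun b hb => by rw [length_word]; exact ((mem_word ρ b).1 hb).2,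
    length_word] at h2
  rw [hρ] at h1 h2 hn hmem
  rw [List.nodup_middle, List.nodup_cons] at hn
  have hmem' (b : ℕ) : b ∈ D ++ τ ↔ 1 < b ∧ b < n + 2 := by
    have := hmem b
    rw [List.mem_append, List.mem_cons, or_left_comm, ← List.mem_append] at this
    rcases eq_or_ne b 1 with rfl | hb
    · simp only [hn.1, false_iff]
      omega
    · rw [or_iff_right hb] at this
      rw [this]
      omega
  have hD : ∀ b ∈ D, 1 < b := fun b hb => ((hmem' b).1 (List.mem_append_left _ hb)).1
  have hτ : ∀ b ∈ τ, 1 < b := fun b hb => ((hmem' b).1 (List.mem_append_right _ hb)).1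
  have hDp := (isPRW_append_one_cons hn.2.of_append_left hD hτ).1 h1
  rw [List.append_assoc, List.cons_append, avoidsTriple_append_one_cons _ hDp hD] at h2
  obtain ⟨s, h⟩ := BlockReversal.exists_of_avoidsTriple hn.2 hDp (fun b hb => ((hmem' b).1 hb).1)
    (fun b hb => ((hmem' b).1 hb).2) (by omega) h2
  have hs (b : ℕ) : b ∈ s ↔ 1 < b ∧ b < n + 2 := by
    rw [h.mem_iff, ← List.mem_append, hmem']
  have hs' : (s.map (· - 1)).map (· + 1) = s := by
    rw [List.map_map]
    refine (List.map_congr_left fun b hb => ?_).trans (List.map_id s)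
    have := (hs b).1 hb
    simp only [Function.comp_apply, id_eq]
    omega
  obtain ⟨σ, hσ⟩ := exists_word_eq (n := n) (w := s.map (· - 1))
    (by
      refine List.Nodup.of_map (· + 1) ?_
      rw [hs']
      exact h.perm.symm.nodup hn.2)
    (fun b => by
      simp only [List.mem_map, hs]
      exact ⟨by rintro ⟨a, ha, rfl⟩; omega, fun hb => ⟨b + 1, by omega, by omega⟩⟩)
  exact ⟨σ, D, τ, by rwa [hσ, hs'], hρ⟩

theorem left_unique {σ σ' : Equiv.Perm (Fin n)} {ρ : Equiv.Perm (Fin (n + 1))}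
    (h : Corresponds σ ρ) (h' : Corresponds σ' ρ) : σ = σ' := by
  obtain ⟨D, τ, h, hρ⟩ := h
  obtain ⟨D', τ', h', hρ'⟩ := h'
  have h1 := h.forall_mem_iff.1 fun b hb => ((mem_map_succ_word σ b).1 hb).1
  have h2 := h'.forall_mem_iff.1 fun b hb => ((mem_map_succ_word σ' b).1 hb).1
  obtain ⟨rfl, -, rfl⟩ := append_cons_inj_of_lt (hρ.symm.trans hρ') h1.1 h1.2 h2.1 h2.2
  exact word_injective (List.map_injective_iff.2 (add_left_injective 1) (h.left_unique h'))

theorem right_unique {σ : Equiv.Perm (Fin n)} {ρ ρ' : Equiv.Perm (Fin (n + 1))}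
    (h : Corresponds σ ρ) (h' : Corresponds σ ρ') : ρ = ρ' := by
  obtain ⟨D, τ, h, hρ⟩ := h
  obtain ⟨D', τ', h', hρ'⟩ := h'
  obtain ⟨rfl, rfl⟩ := h.right_unique h'
  exact word_injective (hρ.trans hρ'.symm)

end Corresponds

/-- equivalence of \eqref{PRW-g-1} and \eqref{PRW-g-3}: the generating
polynomial of `LRmin + RLmin - 2` over permutations in `PRW_{n+1}` with `k` ascents and no
double ascents equals the generating polynomial of `RLmin` over permutations `σ ∈ S_n` with
`k` descents and no index `1 < i < n` with `σ_{i-1} > σ_i > σ_{i+1}`, in `ℤ[α]`. -/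
theorem gamma_NDD_interpretation (n k : ℕ) (hn : 1 ≤ n) :
    ∑ σ ∈ (PRW (n + 1)).filter (fun σ => ascW (word σ) = k ∧ daW (word σ) = 0),
        (Polynomial.X : Polynomial ℤ) ^ (lrminW (word σ) + rlminW (word σ) - 2)
      = ∑ σ ∈ (Finset.univ : Finset (Equiv.Perm (Fin n))).filter
            (fun σ => desW (word σ) = k ∧ noInternalDD (word σ)),
          (Polynomial.X : Polynomial ℤ) ^ rlminW (word σ) := by
  symm
  choose f hf using Corresponds.exists_right (n := n)
  refine Finset.sum_bij (fun σ _ => f σ) (fun σ hσ => ?_) (fun σ _ σ' _ h => ?_)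
    (fun ρ hρ => ?_) (fun σ _ => ?_)
  · simp only [PRW, Finset.mem_filter, Finset.mem_univ, true_and] at hσ ⊢
    rw [(hf σ).ascW_word, (hf σ).daW_word_eq_zero_iff]
    exact ⟨(hf σ).isPRW_word, hσ⟩
  · exact (hf σ).left_unique (h ▸ hf σ')
  · simp only [PRW, Finset.mem_filter, Finset.mem_univ, true_and] at hρ ⊢
    obtain ⟨σ, h⟩ := Corresponds.exists_left hρ.1 hρ.2.2
    rw [h.ascW_word, h.daW_word_eq_zero_iff] at hρ
    exact ⟨σ, hρ.2, (hf σ).right_unique h⟩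
  · rw [(hf σ).lrminW_add_rlminW_word, Nat.add_sub_cancel]
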